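/- Let G=(V,E) be a d-manifold, let ψ:V→ℂ with Re ψ and Im ψ nowhere zero on V, and let t be any 3-element subset of U={1+i,1−i,−1+i,−1−i}. Then Ψ^{-1}(t) is either the empty graph or a (d−2)-manifold with boundary. -/

import Mathlib

open scoped Classical

/-- A finite simple graph: a finite vertex set together with a symmetric, irreflexive
adjacency relation supported on the vertex set. -/
structure FGraph (V : Type) where
  verts : Finset V
  Adj : V → V → Prop
  symm : ∀ {a b}, Adj a b → Adj b a
  loopless : ∀ a, ¬ Adj a a
  mem_of_adj : ∀ {a b}, Adj a b → a ∈ verts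

namespace FGraph

variable {V W : Type}

/-- The subgraph induced on the vertices satisfying `P`. -/
noncomputable def induce (G : FGraph V) (P : V → Prop) : FGraph V where
  verts := G.verts.filter P
  Adj a b := G.Adj a b ∧ P a ∧ P b
  symm h := ⟨G.symm h.1, h.2.2, h.2.1⟩
  loopless a h := G.loopless a h.1
  mem_of_adj h := Finset.mem_filter.mpr ⟨G.mem_of_adj h.1, h.2.1⟩

/-- The unit sphere of a vertex: the subgraph induced on its neighbors. -/
noncomputable def unitSphere (G : FGraph V) (v : V) : FGraph V :=
  G.induce (fun w => G.Adj v w)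

/-- The graph with the vertex `v` (and its edges) removed. -/
noncomputable def erase (G : FGraph V) (v : V) : FGraph V :=
  G.induce (fun w => w ≠ v)

/-- Inductive definition of contractibility: the one-point graph is contractible, and a
graph is contractible if some vertex has a contractible unit sphere and contractible
complement. -/
inductive Contractible : FGraph V → Prop
  | single (G : FGraph V) (v : V) (h : G.verts = {v}) : Contractible G
  | step (G : FGraph V) (v : V) (hv : v ∈ G.verts)
      (h1 : Contractible (G.unitSphere v)) (h2 : Contractible (G.erase v)) :
      Contractible G

mutual
  /-- `G` is a `d`-sphere: the empty graph is the `(-1)`-sphere, and a `d`-manifold is a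
  `d`-sphere if removing some vertex renders it contractible. -/
  inductive IsSphere : ℤ → FGraph V → Prop
    | empty (G : FGraph V) (h : G.verts = ∅) : IsSphere (-1) G
    | punctured (d : ℤ) (G : FGraph V) (hm : IsManifold d G) (v : V) (hv : v ∈ G.verts)
        (hc : Contractible (G.erase v)) : IsSphere d G
  /-- For `d ≥ 0`, `G` is a `d`-manifold iff every unit sphere is a `(d-1)`-sphere. -/
  inductive IsManifold : ℤ → FGraph V → Prop
    | intro (d : ℤ) (hd : 0 ≤ d) (G : FGraph V)
        (h : ∀ v ∈ G.verts, IsSphere (d - 1) (G.unitSphere v)) : IsManifold d G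
end

/-- A simplex of `G`: the vertex set of a complete subgraph. -/
def IsSimplex (G : FGraph V) (x : Finset V) : Prop :=
  x.Nonempty ∧ ↑x ⊆ G.verts ∧ ∀ a ∈ x, ∀ b ∈ x, a ≠ b → G.Adj a b

/-- The Barycentric refinement: vertices are the simplices of `G`, two being adjacent iff
one is strictly contained in the other. -/
noncomputable def barycentric (G : FGraph V) : FGraph (Finset V) where
  verts := G.verts.powerset.filter (fun x => G.IsSimplex x)
  Adj x y := G.IsSimplex x ∧ G.IsSimplex y ∧ (x ⊂ y ∨ y ⊂ x)
  symm h := ⟨h.2.1, h.1, h.2.2.symm⟩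
  loopless x h := by rcases h.2.2 with h' | h' <;> exact (ssubset_irrefl x h')
  mem_of_adj h := Finset.mem_filter.mpr ⟨Finset.mem_powerset.mpr h.1.2.1, h.1⟩

/-- Number of simplices of `G` with exactly `j` vertices (so `numSimplices G (k+1)` is
the `f`-vector entry `f_k(G)`). -/
noncomputable def numSimplices (G : FGraph V) (j : ℕ) : ℕ :=
  (G.verts.powerset.filter (fun x => G.IsSimplex x ∧ x.card = j)).card

/-- Euler characteristic `χ(G) = Σ_{k ≥ 0} (-1)^k f_k(G)`, where `f_k` counts the
simplices with `k+1` vertices. -/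
noncomputable def euler (G : FGraph V) : ℤ :=
  ∑ k ∈ Finset.range G.verts.card, (-1 : ℤ) ^ k * G.numSimplices (k + 1)

/-- The level set `{f = c}`: the subgraph of the Barycentric refinement induced by the
simplices on which `f - c` changes sign. -/
noncomputable def levelSet (G : FGraph V) (f : V → ℝ) (c : ℝ) : FGraph (Finset V) :=
  G.barycentric.induce (fun x => (∃ a ∈ x, f a - c < 0) ∧ (∃ b ∈ x, 0 < f b - c))

/-- Graph isomorphism. -/
def Iso (G : FGraph V) (H : FGraph W) : Prop :=
  ∃ φ : V → W, Set.BijOn φ ↑G.verts ↑H.verts ∧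
    ∀ a ∈ G.verts, ∀ b ∈ G.verts, (G.Adj a b ↔ H.Adj (φ a) (φ b))

/-- Zykov join of two graphs: disjoint union plus all edges between the two parts. -/
noncomputable def join (G : FGraph V) (H : FGraph W) : FGraph (V ⊕ W) where
  verts := G.verts.disjSum H.verts
  Adj a b :=
    match a, b with
    | .inl a, .inl b => G.Adj a b
    | .inr a, .inr b => H.Adj a b
    | .inl a, .inr b => a ∈ G.verts ∧ b ∈ H.verts
    | .inr a, .inl b => b ∈ G.verts ∧ a ∈ H.verts
  symm {a b} h := by
    cases a <;> cases b <;> simp_all <;> first | exact G.symm h | exact H.symm h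
  loopless a h := by
    cases a <;> simp_all <;> first | exact G.loopless _ h | exact H.loopless _ h
  mem_of_adj {a b} h := by
    cases a <;> cases b <;> simp_all [Finset.mem_disjSum] <;>
      first | exact G.mem_of_adj h | exact H.mem_of_adj h

/-- Union of two graphs on the same vertex type. -/
noncomputable def union (G H : FGraph V) : FGraph V where
  verts := G.verts ∪ H.verts
  Adj a b := G.Adj a b ∨ H.Adj a b
  symm h := h.imp G.symm H.symm
  loopless a h := h.elim (G.loopless a) (H.loopless a)
  mem_of_adj h :=
    h.elim (fun h' => Finset.mem_union_left _ (G.mem_of_adj h'))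
      (fun h' => Finset.mem_union_right _ (H.mem_of_adj h'))

/-- A `d`-ball: a graph of the form `S - v` for a `d`-sphere `S` and a vertex `v` of `S`
(up to graph isomorphism). -/
def IsBall (d : ℤ) (H : FGraph W) : Prop :=
  ∃ (S : FGraph ℕ) (v : ℕ), IsSphere d S ∧ v ∈ S.verts ∧ Iso H (S.erase v)

/-- A `d`-manifold with boundary: every unit sphere is a `(d-1)`-sphere or a `(d-1)`-ball. -/
def IsManifoldWithBoundary (d : ℤ) (G : FGraph V) : Prop :=
  ∀ v ∈ G.verts, IsSphere (d - 1) (G.unitSphere v) ∨ IsBall (d - 1) (G.unitSphere v)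

/-- The cyclic graph `C_n` on the vertex set `Fin n`. -/
def cycleGraph (n : ℕ) : FGraph (Fin n) where
  verts := Finset.univ
  Adj a b := a ≠ b ∧ ((a.val + 1) % n = b.val ∨ (b.val + 1) % n = a.val)
  symm h := ⟨h.1.symm, h.2.symm⟩
  loopless a h := h.1 rfl
  mem_of_adj _ := Finset.mem_univ _

/-- `G` is a disjoint union of cyclic graphs `C_n` with `n ≥ 4`: the vertex set splits
into pairwise disjoint pieces, edges never cross between pieces, and each piece induces
a graph isomorphic to a `C_n` with `n ≥ 4`. -/
def IsDisjointUnionOfCycles (G : FGraph V) : Prop :=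
  ∃ P : Finset (Finset V),
    (∀ S ∈ P, ↑S ⊆ G.verts) ∧
    (∀ S ∈ P, ∀ T ∈ P, S ≠ T → Disjoint S T) ∧
    (∀ v ∈ G.verts, ∃ S ∈ P, v ∈ S) ∧
    (∀ a b, G.Adj a b → ∀ S ∈ P, a ∈ S → b ∈ S) ∧
    (∀ S ∈ P, ∃ n, 4 ≤ n ∧ Iso (G.induce (· ∈ S)) (cycleGraph n))

/-- Poincaré–Hopf index `i_f(v) = 1 - χ(S^-_f(v))`. -/
noncomputable def pindex (G : FGraph V) (f : V → ℝ) (v : V) : ℤ :=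
  1 - ((G.unitSphere v).induce (fun w => f w < f v)).euler

/-- Curvature `K(v) = Σ_{k ≥ 0} (-1)^k f_{k-1}(S(v))/(k+1)` with `f_{-1} = 1`. -/
noncomputable def curvature (G : FGraph V) (v : V) : ℝ :=
  ∑ k ∈ Finset.range (G.verts.card + 1),
    (-1 : ℝ) ^ k * (if k = 0 then 1 else ((G.unitSphere v).numSimplices k : ℝ)) / (k + 1)

end FGraph

/-- `sign(a + i b) = sign(a) + i sign(b)`. -/
noncomputable def csgn (z : ℂ) : ℂ :=
  ⟨Real.sign z.re, Real.sign z.im⟩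

/-- The set `U = {1+i, 1-i, -1+i, -1-i}` of possible values of `csgn`. -/
noncomputable def signU : Finset ℂ :=
  {1 + Complex.I, 1 - Complex.I, -1 + Complex.I, -1 - Complex.I}

namespace FGraph

variable {V : Type}

/-- The set of values of `sign(ψ - c)` attained on the finite vertex set `x`. -/
noncomputable def signValues (ψ : V → ℂ) (c : ℂ) (x : Finset V) : Finset ℂ :=
  x.image (fun v => csgn (ψ v - c))

/-- The level set `{ψ = c}` of a complex-valued function: the subgraph of the Barycentric
refinement induced by the simplices on which `sign(ψ - c)` takes at least three distinct
values, including `-1+i` and `1-i`. -/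
noncomputable def complexLevelSet (G : FGraph V) (ψ : V → ℂ) (c : ℂ) : FGraph (Finset V) :=
  G.barycentric.induce (fun x =>
    3 ≤ (signValues ψ c x).card ∧
    (-1 + Complex.I) ∈ signValues ψ c x ∧ (1 - Complex.I) ∈ signValues ψ c x)

/-- The level set `{ψ = 0}_e` for a two-element subset `e ⊆ U`: the subgraph of the
Barycentric refinement induced by the simplices on which `sign(ψ)` attains both values
of `e` and at least three distinct values in total. -/
noncomputable def complexLevelSetE (G : FGraph V) (ψ : V → ℂ) (e : Finset ℂ) :
    FGraph (Finset V) :=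
  G.barycentric.induce (fun x =>
    (∀ u ∈ e, u ∈ signValues ψ 0 x) ∧ 3 ≤ (signValues ψ 0 x).card)

/-- `Ψ^{-1}(t)`: the subgraph of the Barycentric refinement induced by the simplices on
which `sign(ψ)` attains all values of `t`. -/
noncomputable def signPreimage (G : FGraph V) (ψ : V → ℂ) (t : Finset ℂ) :
    FGraph (Finset V) :=
  G.barycentric.induce (fun x => ∀ u ∈ t, u ∈ signValues ψ 0 x)

/-- The sign vectors of `F - c` attained on the finite vertex set `x`. -/
noncomputable def vecSignValues {k : ℕ} (F : V → Fin k → ℝ) (c : Fin k → ℝ)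
    (x : Finset V) : Finset (Fin k → ℝ) :=
  x.image (fun v j => Real.sign (F v j - c j))

/-- The level set `{F = c}` of an `ℝ^k`-valued function: the subgraph of the Barycentric
refinement induced by the simplices on which the sign vector of `F - c` takes at least
`k+1` distinct values, including the `k` vectors `(1,…,1,-1,1,…,1)`. -/
noncomputable def vecLevelSet (G : FGraph V) {k : ℕ} (F : V → Fin k → ℝ) (c : Fin k → ℝ) :
    FGraph (Finset V) :=
  G.barycentric.induce (fun x =>
    k + 1 ≤ (vecSignValues F c x).card ∧
    ∀ j : Fin k, (fun i => if i = j then (-1 : ℝ) else 1) ∈ vecSignValues F c x)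

end FGraph

/-- The complete graph on `Fin n`. -/
def completeFGraph (n : ℕ) : FGraph (Fin n) where
  verts := Finset.univ
  Adj a b := a ≠ b
  symm h := h.symm
  loopless a h := h rfl
  mem_of_adj _ := Finset.mem_univ _

/-- Stirling numbers of the second kind. -/
def stirling2 : ℕ → ℕ → ℕ
  | 0, 0 => 1
  | 0, _ + 1 => 0
  | _ + 1, 0 => 0
  | n + 1, m + 1 => (m + 1) * stirling2 n (m + 1) + stirling2 n m

namespace FGraph

section RelGraph

variable {α β : Type}

theorem ext {G H : FGraph α} (hv : G.verts = H.verts) (ha : ∀ a b, G.Adj a b ↔ H.Adj a b) :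
    G = H := by
  cases G
  cases H
  simp only at hv ha
  subst hv
  congr
  funext a b
  exact propext (ha a b)

theorem mem_of_adj_right (G : FGraph α) {a b : α} (h : G.Adj a b) : b ∈ G.verts :=
  G.mem_of_adj (G.symm h)

theorem mem_induce {G : FGraph α} {P : α → Prop} {v : α} :
    v ∈ (G.induce P).verts ↔ v ∈ G.verts ∧ P v :=
  Finset.mem_filter

theorem contractible_iff {G : FGraph α} :
    Contractible G ↔ (∃ v, G.verts = {v}) ∨
      ∃ v ∈ G.verts, Contractible (G.unitSphere v) ∧ Contractible (G.erase v) := by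
  constructor
  · rintro (⟨_, v, h⟩ | ⟨_, v, hv, h1, h2⟩)
    · exact .inl ⟨v, h⟩
    · exact .inr ⟨v, hv, h1, h2⟩
  · rintro (⟨v, h⟩ | ⟨v, hv, h1, h2⟩)
    · exact .single G v h
    · exact .step G v hv h1 h2

theorem isManifold_iff {d : ℤ} {G : FGraph α} :
    IsManifold d G ↔ 0 ≤ d ∧ ∀ v ∈ G.verts, IsSphere (d - 1) (G.unitSphere v) := by
  constructor
  · rintro ⟨_, hd, _, h⟩
    exact ⟨hd, h⟩
  · rintro ⟨hd, h⟩
    exact .intro d hd G h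

theorem isSphere_iff {d : ℤ} {G : FGraph α} :
    IsSphere d G ↔ (d = -1 ∧ G.verts = ∅) ∨
      (IsManifold d G ∧ ∃ v ∈ G.verts, Contractible (G.erase v)) := by
  constructor
  · rintro (⟨_, h⟩ | ⟨_, _, hm, v, hv, hc⟩)
    · exact .inl ⟨rfl, h⟩
    · exact .inr ⟨hm, v, hv, hc⟩
  · rintro (⟨rfl, h⟩ | ⟨hm, v, hv, hc⟩)
    · exact .empty G h
    · exact .punctured d G hm v hv hc

/-- The elements of `s` satisfying `P`, filtered with the classical decision procedure. -/
noncomputable def _root_.Finset.keep (s : Finset α) (P : α → Prop) : Finset α := s.filter P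

theorem _root_.Finset.mem_keep {s : Finset α} {P : α → Prop} {a : α} :
    a ∈ s.keep P ↔ a ∈ s ∧ P a :=
  Finset.mem_filter

theorem _root_.Finset.keep_subset (s : Finset α) (P : α → Prop) : s.keep P ⊆ s :=
  Finset.filter_subset P s

/-- Distinct elements related by `R` in one of the two directions. -/
def Linked (R : α → α → Prop) (v w : α) : Prop := v ≠ w ∧ (R v w ∨ R w v)

theorem Linked.symm {R : α → α → Prop} {v w : α} (h : Linked R v w) : Linked R w v :=
  ⟨h.1.symm, h.2.symm⟩

/-- The graph on the finite set `s` whose edges are the pairs linked by `R`. -/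
def relGraph (R : α → α → Prop) (s : Finset α) : FGraph α where
  verts := s
  Adj a b := a ∈ s ∧ b ∈ s ∧ Linked R a b
  symm h := ⟨h.2.1, h.1, h.2.2.symm⟩
  loopless _ h := h.2.2.1 rfl
  mem_of_adj h := h.1

theorem relGraph_congr {R R' : α → α → Prop} {s : Finset α}
    (h : ∀ a ∈ s, ∀ b ∈ s, R a b ↔ R' a b) : relGraph R s = relGraph R' s := by
  refine ext rfl fun a b => and_congr_right fun ha => and_congr_right fun hb => ?_
  simp only [Linked, h a ha b hb, h b hb a ha]

theorem relGraph_flip (R : α → α → Prop) (s : Finset α) :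
    relGraph (fun a b => R b a) s = relGraph R s := by
  refine ext rfl fun a b => and_congr_right fun _ => and_congr_right fun _ => ?_
  simp only [Linked, or_comm]

theorem unitSphere_relGraph {R : α → α → Prop} {s : Finset α} {v : α} (hv : v ∈ s) :
    (relGraph R s).unitSphere v = relGraph R (s.keep (Linked R v)) := by
  refine ext ?_ fun a b => ?_
  · ext w
    exact Finset.mem_keep.trans
      ⟨fun h => Finset.mem_keep.mpr ⟨h.1, h.2.2.2⟩,
        fun h => ⟨(Finset.mem_keep.mp h).1, hv, Finset.mem_keep.mp h⟩⟩
  · simp only [unitSphere, induce, relGraph, Finset.mem_keep]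
    tauto

theorem erase_relGraph {R : α → α → Prop} {s : Finset α} {v : α} :
    (relGraph R s).erase v = relGraph R (s.keep (· ≠ v)) := by
  refine ext ?_ fun a b => ?_
  · rfl
  · simp only [erase, induce, relGraph, Finset.mem_keep]
    tauto

theorem contractible_relGraph_step {R : α → α → Prop} {s : Finset α} {v : α} (hv : v ∈ s)
    (h1 : Contractible (relGraph R (s.keep (Linked R v))))
    (h2 : Contractible (relGraph R (s.keep (· ≠ v)))) : Contractible (relGraph R s) :=
  .step _ v hv (by rwa [unitSphere_relGraph hv]) (by rwa [erase_relGraph])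

theorem contractible_relGraph_iff {R : α → α → Prop} {s : Finset α} :
    Contractible (relGraph R s) ↔ (∃ v, s = {v}) ∨
      ∃ v ∈ s, Contractible (relGraph R (s.keep (Linked R v))) ∧
        Contractible (relGraph R (s.keep (· ≠ v))) := by
  rw [contractible_iff]
  refine or_congr Iff.rfl (exists_congr fun v => and_congr_right fun (hv : v ∈ s) => ?_)
  rw [unitSphere_relGraph hv, erase_relGraph]

theorem isManifold_relGraph_iff {R : α → α → Prop} {s : Finset α} {d : ℤ} :
    IsManifold d (relGraph R s) ↔
      0 ≤ d ∧ ∀ v ∈ s, IsSphere (d - 1) (relGraph R (s.keep (Linked R v))) := by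
  rw [isManifold_iff]
  refine and_congr_right fun _ => forall_congr' fun v => forall_congr' fun (hv : v ∈ s) => ?_
  rw [unitSphere_relGraph hv]

theorem isSphere_relGraph_iff {R : α → α → Prop} {s : Finset α} {d : ℤ} :
    IsSphere d (relGraph R s) ↔ (d = -1 ∧ s = ∅) ∨
      (IsManifold d (relGraph R s) ∧ ∃ v ∈ s, Contractible (relGraph R (s.keep (· ≠ v)))) := by
  rw [isSphere_iff]
  simp only [erase_relGraph]
  rfl

theorem card_keep_lt_of_mem {s : Finset α} {P : α → Prop} {v : α} (hv : v ∈ s) (h : ¬ P v) :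
    (s.keep P).card < s.card :=
  Finset.card_lt_card (Finset.filter_ssubset.mpr ⟨v, hv, h⟩)

theorem card_keep_ne_lt {s : Finset α} {v : α} (hv : v ∈ s) :
    (s.keep (· ≠ v)).card < s.card :=
  card_keep_lt_of_mem (P := (· ≠ v)) hv fun h => h rfl

theorem card_keep_linked_lt {R : α → α → Prop} {s : Finset α} {v : α} (hv : v ∈ s) :
    (s.keep (Linked R v)).card < s.card :=
  card_keep_lt_of_mem hv fun h => h.1 rfl

theorem contractible_of_cone {R : α → α → Prop} {s : Finset α} {a : α} (ha : a ∈ s)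
    (h : ∀ b ∈ s, b ≠ a → Linked R a b) : Contractible (relGraph R s) := by
  induction hn : s.card using Nat.strong_induction_on generalizing s with
  | _ n ih =>
    by_cases hs : ∃ b ∈ s, b ≠ a
    · obtain ⟨b, hb, hba⟩ := hs
      refine contractible_relGraph_step hb
        (ih _ (hn ▸ card_keep_linked_lt hb) ?_ ?_ rfl)
        (ih _ (hn ▸ card_keep_ne_lt hb) ?_ ?_ rfl)
      · exact Finset.mem_keep.mpr ⟨ha, (h b hb hba).symm⟩
      · exact fun c hc => h c (Finset.mem_keep.mp hc).1
      · exact Finset.mem_keep.mpr ⟨ha, hba.symm⟩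
      · exact fun c hc => h c (Finset.mem_keep.mp hc).1
    · push Not at hs
      exact contractible_relGraph_iff.mpr
        (.inl ⟨a, Finset.eq_singleton_iff_unique_mem.mpr ⟨ha, hs⟩⟩)

theorem contractible_of_dominated {R : α → α → Prop} {s : Finset α} {v w : α} (hv : v ∈ s)
    (hw : w ∈ s) (hvw : Linked R v w) (h : ∀ u ∈ s, Linked R v u → u ≠ w → Linked R w u)
    (hc : Contractible (relGraph R (s.keep (· ≠ v)))) : Contractible (relGraph R s) := by
  refine contractible_relGraph_step hv
    (contractible_of_cone (Finset.mem_keep.mpr ⟨hw, hvw⟩) ?_) hc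
  intro b hb
  obtain ⟨hb, hb'⟩ := Finset.mem_keep.mp hb
  exact h b hb hb'

/-- A finite set with a strict order deformation retracts onto a subset `s₀` along a map `f`
sending each `y ∉ s₀` to the least element of `s₀` above it. -/
theorem contractible_of_retract {R : α → α → Prop} (hR : ∀ a b c, R a b → R b c → R a c)
    (r : α → ℤ) (hr : ∀ a b, R a b → r a < r b) {s s₀ : Finset α} (hs : s₀ ⊆ s) (f : α → α)
    (hf : ∀ y ∈ s, y ∉ s₀ → f y ∈ s₀ ∧ R y (f y) ∧
      ∀ z ∈ s₀, R y z → z ≠ f y → R (f y) z)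
    (hc : Contractible (relGraph R s₀)) : Contractible (relGraph R s) := by
  induction hn : s.card using Nat.strong_induction_on generalizing s with
  | _ n ih =>
    by_cases hne : (s \ s₀).Nonempty
    · obtain ⟨y, hy, hmax⟩ := Finset.exists_max_image _ r hne
      obtain ⟨hys, hy₀⟩ := Finset.mem_sdiff.mp hy
      obtain ⟨hfy, hyf, hz⟩ := hf y hys hy₀
      refine contractible_of_dominated hys (hs hfy)
        ⟨fun h => hy₀ (h ▸ hfy), .inl hyf⟩ ?_
        (ih _ (hn ▸ card_keep_ne_lt hys) ?_ ?_ rfl)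
      · rintro u hu ⟨hyu, hu' | hu'⟩ huf
        · by_cases hu₀ : u ∈ s₀
          · exact ⟨huf.symm, .inl (hz u hu₀ hu' huf)⟩
          · exact absurd (hr _ _ hu') (hmax u (Finset.mem_sdiff.mpr ⟨hu, hu₀⟩)).not_gt
        · exact ⟨huf.symm, .inr (hR _ _ _ hu' hyf)⟩
      · exact fun z hz => Finset.mem_keep.mpr ⟨hs hz, fun h => hy₀ (h ▸ hz)⟩
      · exact fun z hz => hf z (Finset.mem_keep.mp hz).1
    · rw [Finset.not_nonempty_iff_eq_empty, Finset.sdiff_eq_empty_iff_subset] at hne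
      rwa [hne.antisymm hs]

theorem Contractible.join {R : α → α → Prop} {A B s : Finset α}
    (hA : Contractible (relGraph R A)) (hs : ∀ v, v ∈ s ↔ v ∈ A ∨ v ∈ B)
    (hAB : ∀ a ∈ A, ∀ b ∈ B, Linked R a b) : Contractible (relGraph R s) := by
  induction hn : A.card using Nat.strong_induction_on generalizing A s with
  | _ n ih =>
    rcases contractible_relGraph_iff.mp hA with ⟨v, rfl⟩ | ⟨v, hv, h1, h2⟩
    · refine contractible_of_cone ((hs v).mpr (.inl (by simp))) fun b hb hbv => ?_
      exact hAB v (by simp) b (((hs b).mp hb).resolve_left (by simpa using hbv))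
    · refine contractible_relGraph_step ((hs v).mpr (.inl hv))
        (ih _ (hn ▸ card_keep_linked_lt hv) h1 ?_ ?_ rfl)
        (ih _ (hn ▸ card_keep_ne_lt hv) h2 ?_ ?_ rfl)
      · intro w
        have := hAB v hv w
        simp only [Finset.mem_keep, hs]
        tauto
      · exact fun a ha => hAB a (Finset.mem_keep.mp ha).1
      · intro w
        have : w ∈ B → w ≠ v := fun hw => (hAB v hv w hw).1.symm
        simp only [Finset.mem_keep, hs]
        tauto
      · exact fun a ha => hAB a (Finset.mem_keep.mp ha).1

/-- The join of a `d`-sphere and an `e`-sphere is a `(d+e+1)`-sphere. -/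
theorem IsSphere.join {R : α → α → Prop} {A B s : Finset α} {d e : ℤ}
    (hA : IsSphere d (relGraph R A)) (hB : IsSphere e (relGraph R B))
    (hs : ∀ v, v ∈ s ↔ v ∈ A ∨ v ∈ B) (hAB : ∀ a ∈ A, ∀ b ∈ B, Linked R a b) :
    IsSphere (d + e + 1) (relGraph R s) := by
  induction hn : A.card + B.card using Nat.strong_induction_on generalizing A B s d e with
  | _ n ih =>
    rcases isSphere_relGraph_iff.mp hA with ⟨rfl, rfl⟩ | ⟨hmA, p, hp, hcp⟩
    · have : s = B := by ext; simp [hs]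
      rw [this]
      simpa using hB
    rcases isSphere_relGraph_iff.mp hB with ⟨rfl, rfl⟩ | ⟨hmB, -⟩
    · have : s = A := by ext; simp [hs]
      rw [this]
      simpa using hA
    obtain ⟨hd, hmA⟩ := isManifold_relGraph_iff.mp hmA
    obtain ⟨he, hmB⟩ := isManifold_relGraph_iff.mp hmB
    refine isSphere_relGraph_iff.mpr (.inr ⟨isManifold_relGraph_iff.mpr ⟨by lia, ?_⟩, p,
      (hs p).mpr (.inl hp), hcp.join (B := B) ?_ ?_⟩)
    · intro v hv
      rcases (hs v).mp hv with hv | hv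
      · have := card_keep_linked_lt (R := R) hv
        rw [show d + e + 1 - 1 = (d - 1) + e + 1 by ring]
        refine ih _ (by lia) (hmA v hv) hB ?_ ?_ rfl
        · intro w
          have := hAB v hv w
          simp only [Finset.mem_keep, hs]
          tauto
        · exact fun a ha => hAB a (Finset.mem_keep.mp ha).1
      · have := card_keep_linked_lt (R := R) hv
        rw [show d + e + 1 - 1 = d + (e - 1) + 1 by ring]
        refine ih _ (by lia) hA (hmB v hv) ?_ ?_ rfl
        · intro w
          have : w ∈ A → Linked R v w := fun hw => (hAB w hw v hv).symm
          simp only [Finset.mem_keep, hs]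
          tauto
        · exact fun a ha b hb => hAB a ha b (Finset.mem_keep.mp hb).1
    · intro w
      have : w ∈ B → w ≠ p := fun hw => (hAB p hp w hw).1.symm
      simp only [Finset.mem_keep, hs]
      tauto
    · exact fun a ha => hAB a (Finset.mem_keep.mp ha).1

/-- `φ` restricts to an isomorphism from `G` to `H`. -/
def IsIso (φ : α → β) (G : FGraph α) (H : FGraph β) : Prop :=
  Set.BijOn φ ↑G.verts ↑H.verts ∧
    ∀ a ∈ G.verts, ∀ b ∈ G.verts, (G.Adj a b ↔ H.Adj (φ a) (φ b))

theorem IsIso.induce {φ : α → β} {G : FGraph α} {H : FGraph β} (h : IsIso φ G H)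
    {P : α → Prop} {Q : β → Prop} (hPQ : ∀ a ∈ G.verts, P a ↔ Q (φ a)) :
    IsIso φ (G.induce P) (H.induce Q) := by
  obtain ⟨⟨hm, hi, hs⟩, ha⟩ := h
  refine ⟨⟨?_, ?_, ?_⟩, ?_⟩
  · intro a haG
    obtain ⟨haG, hP⟩ := Finset.mem_filter.mp haG
    exact Finset.mem_filter.mpr ⟨hm haG, (hPQ a haG).mp hP⟩
  · exact hi.mono fun a haG => (Finset.mem_filter.mp haG).1
  · intro b hb
    obtain ⟨hb, hQ⟩ := Finset.mem_filter.mp hb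
    obtain ⟨a, haG, rfl⟩ := hs hb
    exact ⟨a, Finset.mem_filter.mpr ⟨haG, (hPQ a haG).mpr hQ⟩, rfl⟩
  · intro a haG b hbG
    have haG := (Finset.mem_filter.mp haG).1
    have hbG := (Finset.mem_filter.mp hbG).1
    simp only [FGraph.induce, ha a haG b hbG, hPQ a haG, hPQ b hbG]

theorem IsIso.unitSphere {φ : α → β} {G : FGraph α} {H : FGraph β} (h : IsIso φ G H) {v : α}
    (hv : v ∈ G.verts) : IsIso φ (G.unitSphere v) (H.unitSphere (φ v)) :=
  h.induce fun a ha => h.2 v hv a ha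

theorem IsIso.erase {φ : α → β} {G : FGraph α} {H : FGraph β} (h : IsIso φ G H) {v : α}
    (hv : v ∈ G.verts) : IsIso φ (G.erase v) (H.erase (φ v)) :=
  h.induce fun _ ha => (h.1.injOn.ne_iff ha hv).symm

theorem IsIso.contractible {φ : α → β} {G : FGraph α} {H : FGraph β} (h : IsIso φ G H)
    (hG : Contractible G) : Contractible H := by
  induction hG generalizing H with
  | single G v hv =>
    refine .single H (φ v) (Finset.coe_injective ?_)
    rw [← h.1.image_eq, hv]
    simp
  | step G v hv _ _ ih1 ih2 =>
    exact .step H (φ v) (h.1.mapsTo hv) (ih1 (h.unitSphere hv)) (ih2 (h.erase hv))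

theorem IsIso.isSphere {φ : α → β} {G : FGraph α} {H : FGraph β} {d : ℤ} (h : IsIso φ G H)
    (hG : IsSphere d G) : IsSphere d H := by
  induction hn : G.verts.card using Nat.strong_induction_on generalizing G H d with
  | _ n ih =>
    rcases isSphere_iff.mp hG with ⟨rfl, hv⟩ | ⟨hm, v, hv, hc⟩
    · refine .empty H (Finset.coe_injective ?_)
      rw [← h.1.image_eq, hv]
      simp
    · obtain ⟨hd, hm⟩ := isManifold_iff.mp hm
      refine .punctured d H (.intro d hd H fun w hw => ?_) (φ v) (h.1.mapsTo hv)
        ((h.erase hv).contractible hc)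
      obtain ⟨u, hu, rfl⟩ := h.1.surjOn hw
      exact ih _ (hn ▸ card_keep_lt_of_mem hu (G.loopless u)) (h.unitSphere hu) (hm u hu) rfl

theorem exists_isIso_nat (G : FGraph α) : ∃ (H : FGraph ℕ) (φ : α → ℕ), IsIso φ G H := by
  obtain ⟨φ, hφ⟩ : ∃ φ : α → ℕ, Set.InjOn φ (G.verts : Set α) :=
    Set.countable_iff_exists_injOn.mp G.verts.countable_toSet
  refine ⟨{ verts := G.verts.image φ
            Adj := fun m n => ∃ a b, G.Adj a b ∧ φ a = m ∧ φ b = n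
            symm := fun ⟨a, b, h, ha, hb⟩ => ⟨b, a, G.symm h, hb, ha⟩
            loopless := ?_
            mem_of_adj := ?_ }, φ, ⟨?_, ?_, ?_⟩, ?_⟩
  · rintro _ ⟨a, b, h, rfl, hb⟩
    rw [hφ (G.mem_of_adj_right h) (G.mem_of_adj h) hb] at h
    exact G.loopless a h
  · rintro _ _ ⟨a, b, h, rfl, rfl⟩
    exact Finset.mem_image_of_mem φ (G.mem_of_adj h)
  · exact fun a ha => Finset.mem_image_of_mem φ ha
  · exact hφ
  · intro n hn
    obtain ⟨a, ha, rfl⟩ := Finset.mem_image.mp hn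
    exact ⟨a, ha, rfl⟩
  · intro a ha b hb
    refine ⟨fun h => ⟨a, b, h, rfl, rfl⟩, ?_⟩
    rintro ⟨a', b', h, ha', hb'⟩
    rwa [hφ (G.mem_of_adj h) ha ha', hφ (G.mem_of_adj_right h) hb hb'] at h

theorem isBall_erase {S : FGraph α} {d : ℤ} (hS : IsSphere d S) {v : α} (hv : v ∈ S.verts) :
    IsBall d (S.erase v) := by
  obtain ⟨H, φ, h⟩ := exists_isIso_nat S
  exact ⟨H, φ v, h.isSphere hS, h.1.mapsTo hv, φ, h.erase hv⟩

end RelGraph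

section Inclusion

/-- The comparability graph of a family of finite sets ordered by inclusion. -/
abbrev inclGraph (s : Finset (Finset V)) : FGraph (Finset V) := relGraph (· ⊂ ·) s

theorem contractible_of_retract_up {s s₀ : Finset (Finset V)} (hs : s₀ ⊆ s)
    (f : Finset V → Finset V)
    (hf : ∀ y ∈ s, y ∉ s₀ → f y ∈ s₀ ∧ y ⊂ f y ∧ ∀ z ∈ s₀, y ⊂ z → f y ⊆ z)
    (hc : Contractible (inclGraph s₀)) : Contractible (inclGraph s) := by
  refine contractible_of_retract (R := (· ⊂ ·)) (fun _ _ _ h h' => h.trans h')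
    (fun y => (y.card : ℤ)) (fun a b h => by exact_mod_cast Finset.card_lt_card h) hs f
    (fun y hy hy₀ => ?_) hc
  obtain ⟨h1, h2, h3⟩ := hf y hy hy₀
  exact ⟨h1, h2, fun z hz hyz hne => (h3 z hz hyz).ssubset_of_ne hne.symm⟩

theorem contractible_of_retract_down {s s₀ : Finset (Finset V)} (hs : s₀ ⊆ s)
    (f : Finset V → Finset V)
    (hf : ∀ y ∈ s, y ∉ s₀ → f y ∈ s₀ ∧ f y ⊂ y ∧ ∀ z ∈ s₀, z ⊂ y → z ⊆ f y)
    (hc : Contractible (inclGraph s₀)) : Contractible (inclGraph s) := by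
  rw [inclGraph, ← relGraph_flip] at hc ⊢
  refine contractible_of_retract (R := fun a b => b ⊂ a) (fun _ _ _ h h' => h'.trans h)
    (fun y => -(y.card : ℤ))
    (fun a b h => neg_lt_neg (by exact_mod_cast Finset.card_lt_card h)) hs f
    (fun y hy hy₀ => ?_) hc
  obtain ⟨h1, h2, h3⟩ := hf y hy hy₀
  exact ⟨h1, h2, fun z hz hyz hne => (h3 z hz hyz).ssubset_of_ne hne⟩

theorem linked_of_ssubset {y z : Finset V} (h : y ⊂ z) : Linked (· ⊂ ·) y z :=
  ⟨h.ne, .inl h⟩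

theorem linked_ssubset_iff {y z : Finset V} : Linked (· ⊂ ·) y z ↔ y ⊂ z ∨ z ⊂ y :=
  ⟨fun h => h.2, fun h => h.elim linked_of_ssubset fun h => (linked_of_ssubset h).symm⟩

/-- The coloring giving each element of `y` its own color and a common color to all others. -/
noncomputable def outsideColor (y : Finset V) (a : V) : Option V := if a ∈ y then some a else none

theorem card_image_outsideColor {x y : Finset V} (h : y ⊂ x) :
    (x.image (outsideColor y)).card = y.card + 1 := by
  have : x.image (outsideColor y) = insert none (y.image some) := by
    ext u
    obtain ⟨b, hb, hby⟩ := Finset.exists_of_ssubset h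
    simp only [Finset.mem_image, Finset.mem_insert, outsideColor]
    constructor
    · rintro ⟨a, -, rfl⟩
      by_cases ha : a ∈ y
      · exact .inr ⟨a, ha, by simp [ha]⟩
      · exact .inl (by simp [ha])
    · rintro (rfl | ⟨a, ha, rfl⟩)
      · exact ⟨b, hb, by simp [hby]⟩
      · exact ⟨a, h.1 ha, by simp [ha]⟩
  rw [this, Finset.card_insert_of_notMem (by simp),
    Finset.card_image_of_injective _ (Option.some_injective V)]

theorem forall_outsideColor_iff {x y z : Finset V} (h : y ⊂ x) :
    (∀ a ∈ x, ∃ b ∈ z, outsideColor y b = outsideColor y a) ↔ y ⊂ z := by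
  have key : ∀ a b, outsideColor y b = outsideColor y a ↔ (a ∈ y ∧ b = a) ∨ (a ∉ y ∧ b ∉ y) := by
    intro a b
    by_cases ha : a ∈ y <;> by_cases hb : b ∈ y <;> simp [outsideColor, ha, hb]
    rintro rfl
    exact hb ha
  simp only [key]
  constructor
  · intro hz
    refine Finset.ssubset_iff_subset_ne.mpr ⟨fun a ha => ?_, ?_⟩
    · obtain ⟨b, hb, ⟨-, rfl⟩ | ⟨h', -⟩⟩ := hz a (h.1 ha)
      · exact hb
      · exact absurd ha h'
    · rintro rfl
      obtain ⟨a, hax, hay⟩ := Finset.exists_of_ssubset h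
      obtain ⟨b, hb, ⟨h', -⟩ | ⟨-, h'⟩⟩ := hz a hax
      · exact hay h'
      · exact h' hb
  · intro hz a _
    by_cases ha : a ∈ y
    · exact ⟨a, hz.1 ha, .inl ⟨ha, rfl⟩⟩
    · obtain ⟨b, hbz, hby⟩ := Finset.exists_of_ssubset hz
      exact ⟨b, hbz, .inr ⟨ha, hby⟩⟩

/-- The proper subsets of `x` on which a coloring attains all the values it has on `x` form a
sphere. -/
theorem isSphere_inclGraph_of_colors {n : ℕ} {K : Type} [DecidableEq K] (c : V → K) {x : Finset V}
    {s : Finset (Finset V)} (hs : ∀ y, y ∈ s ↔ y ⊂ x ∧ ∀ a ∈ x, ∃ b ∈ y, c b = c a)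
    (hn : x.card = (x.image c).card + n) : IsSphere (n - 1) (inclGraph s) := by
  induction n using Nat.strong_induction_on generalizing K c x s with
  | _ n ih =>
    by_cases hinj : Set.InjOn c x
    · rw [Finset.card_image_of_injOn hinj] at hn
      obtain rfl : n = 0 := by lia
      refine .empty _ (Finset.eq_empty_of_forall_notMem fun y hy => ?_)
      obtain ⟨hyx, hy⟩ := (hs y).mp hy
      refine hyx.2 fun a ha => ?_
      obtain ⟨b, hb, hba⟩ := hy a ha
      rwa [← hinj (hyx.1 hb) ha hba]
    · have hn0 : n ≠ 0 := by
        rintro rfl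
        exact hinj (Finset.card_image_iff.mp hn.symm)
      simp only [Set.InjOn, not_forall] at hinj
      obtain ⟨a, ha, b, hb, hab, hne⟩ := hinj
      rw [Finset.mem_coe] at ha hb
      refine isSphere_relGraph_iff.mpr (.inr ⟨isManifold_relGraph_iff.mpr ⟨by lia, ?_⟩,
        x.erase a, ?_, ?_⟩)
      · intro y hys
        obtain ⟨hyx, hy⟩ := (hs y).mp hys
        have himg : y.image c = x.image c := by
          refine (Finset.image_subset_image hyx.1).antisymm fun u hu => ?_
          obtain ⟨e, he, rfl⟩ := Finset.mem_image.mp hu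
          exact Finset.mem_image.mpr (hy e he)
        have hle : (x.image c).card ≤ y.card := himg ▸ Finset.card_image_le
        have hlt := Finset.card_lt_card hyx
        have hlow := ih (y.card - (x.image c).card) (by lia) c (x := y)
          (s := s.keep (· ⊂ y)) (fun z => by
            rw [Finset.mem_keep, hs]
            constructor
            · exact fun h => ⟨h.2, fun e he => h.1.2 e (hyx.1 he)⟩
            · refine fun h => ⟨⟨h.1.trans hyx, fun e he => ?_⟩, h.1⟩
              obtain ⟨f, hf, hfe⟩ := hy e he
              obtain ⟨g, hg, hgf⟩ := h.2 f hf
              exact ⟨g, hg, hgf.trans hfe⟩) (by rw [himg]; lia)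
        have hpos : 0 < (x.image c).card := Finset.card_pos.mpr ⟨_, Finset.mem_image_of_mem c ha⟩
        have hupp := ih (x.card - (y.card + 1)) (by lia) (outsideColor y) (x := x)
          (s := s.keep (y ⊂ ·)) (fun z => by
            rw [Finset.mem_keep, hs, forall_outsideColor_iff hyx]
            constructor
            · exact fun h => ⟨h.1.1, h.2⟩
            · refine fun h => ⟨⟨h.1, fun e he => ?_⟩, h.2⟩
              obtain ⟨f, hf, hfe⟩ := hy e he
              exact ⟨f, h.2.1 hf, hfe⟩) (by rw [card_image_outsideColor hyx]; lia)
        have := hlow.join hupp (s := s.keep (Linked (· ⊂ ·) y))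
          (fun z => by
            simp only [Finset.mem_keep, linked_ssubset_iff]
            tauto)
          (fun z hz w hw => linked_of_ssubset
            ((Finset.mem_keep.mp hz).2.trans (Finset.mem_keep.mp hw).2))
        convert this using 1
        push_cast [hle, Nat.succ_le_of_lt hlt]
        have : (x.card : ℤ) = (x.image c).card + n := by exact_mod_cast hn
        lia
      · refine (hs _).mpr ⟨Finset.erase_ssubset ha, fun e he => ?_⟩
        by_cases hea : e = a
        · exact ⟨b, Finset.mem_erase.mpr ⟨Ne.symm hne, hb⟩, by rw [hea, hab]⟩
        · exact ⟨e, Finset.mem_erase.mpr ⟨hea, he⟩, rfl⟩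
      · refine contractible_of_retract_up
          (s₀ := (s.keep (· ≠ x.erase a)).keep (a ∈ ·)) (Finset.keep_subset _ _)
          (insert a) ?_ (contractible_of_retract_down
            (s₀ := s.keep fun y => a ∈ y ∧ b ∉ y) ?_ (·.erase b) ?_
            (contractible_of_cone (a := x.erase b) ?_ ?_))
        · intro y hy hy₀
          obtain ⟨hys, hyne⟩ := Finset.mem_keep.mp hy
          have hay : a ∉ y := fun h => hy₀ (Finset.mem_keep.mpr ⟨hy, h⟩)
          obtain ⟨hyx, hyc⟩ := (hs y).mp hys
          refine ⟨?_, Finset.ssubset_insert hay, fun z hz hyz =>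
            Finset.insert_subset (Finset.mem_keep.mp hz).2 hyz.1⟩
          simp only [Finset.mem_keep, hs]
          refine ⟨⟨⟨(Finset.insert_subset ha hyx.1).ssubset_of_ne ?_, fun e he => ?_⟩, ?_⟩,
            Finset.mem_insert_self a y⟩
          · rintro h
            exact hyne (by rw [← h, Finset.erase_insert hay])
          · obtain ⟨f, hf, hfe⟩ := hyc e he
            exact ⟨f, Finset.mem_insert_of_mem hf, hfe⟩
          · intro h
            exact Finset.notMem_erase a x (h ▸ Finset.mem_insert_self a y)
        · intro y hy
          simp only [Finset.mem_keep] at hy ⊢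
          exact ⟨⟨hy.1, fun h => Finset.notMem_erase a x (h ▸ hy.2.1)⟩, hy.2.1⟩
        · intro y hy hy₀
          simp only [Finset.mem_keep] at hy hy₀
          have hby : b ∈ y := by tauto
          obtain ⟨hyx, hyc⟩ := (hs y).mp hy.1.1
          have hay : a ∈ y.erase b := Finset.mem_erase.mpr ⟨hne, hy.2⟩
          refine ⟨Finset.mem_keep.mpr ⟨(hs _).mpr
            ⟨(Finset.erase_subset b y).trans_ssubset hyx, fun e he => ?_⟩, hay,
            Finset.notMem_erase b y⟩, Finset.erase_ssubset hby, fun z hz hzy => ?_⟩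
          · obtain ⟨f, hf, hfe⟩ := hyc e he
            by_cases hfb : f = b
            · exact ⟨a, hay, by rw [hab, ← hfb, hfe]⟩
            · exact ⟨f, Finset.mem_erase.mpr ⟨hfb, hf⟩, hfe⟩
          · exact Finset.subset_erase.mpr ⟨hzy.1, (Finset.mem_keep.mp hz).2.2⟩
        · refine Finset.mem_keep.mpr ⟨(hs _).mpr ⟨Finset.erase_ssubset hb, fun e he => ?_⟩,
            Finset.mem_erase.mpr ⟨hne, ha⟩, Finset.notMem_erase b x⟩
          by_cases heb : e = b
          · exact ⟨a, Finset.mem_erase.mpr ⟨hne, ha⟩, by rw [heb, hab]⟩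
          · exact ⟨e, Finset.mem_erase.mpr ⟨heb, he⟩, rfl⟩
        · intro y hy hyne
          obtain ⟨hy, -, hby⟩ := Finset.mem_keep.mp hy
          exact (linked_of_ssubset ((Finset.subset_erase.mpr
            ⟨((hs y).mp hy).1.1, hby⟩).ssubset_of_ne hyne)).symm

/-- An open interval of finite sets is a sphere. -/
theorem isSphere_inclGraph_Ioo {x y : Finset V} (hyx : y ⊂ x) {s : Finset (Finset V)}
    (hs : ∀ z, z ∈ s ↔ y ⊂ z ∧ z ⊂ x) : IsSphere (x.card - y.card - 2) (inclGraph s) := by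
  have hlt := Finset.card_lt_card hyx
  have := isSphere_inclGraph_of_colors (n := x.card - (y.card + 1)) (outsideColor y) (x := x)
    (s := s) (fun z => by rw [hs, forall_outsideColor_iff hyx, and_comm])
    (by rw [card_image_outsideColor hyx]; lia)
  convert this using 1
  push_cast [Nat.succ_le_of_lt hlt]
  ring

/-- The inclusion relation, except that the empty set is only below those sets which have an
element of a color outside `t`. -/
def ballRel {K : Type} (c : V → K) (t : Finset K) (y z : Finset V) : Prop :=
  y ⊂ z ∧ (y = ∅ → ∃ a ∈ z, c a ∉ t)

theorem ballRel_iff {K : Type} {c : V → K} {t : Finset K} {y z : Finset V} (hy : y ≠ ∅) :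
    ballRel c t y z ↔ y ⊂ z := by
  simp [ballRel, hy]

theorem relGraph_ballRel {K : Type} {c : V → K} {t : Finset K} {s : Finset (Finset V)}
    (hs : ∀ y ∈ s, y ≠ ∅) : relGraph (ballRel c t) s = inclGraph s :=
  relGraph_congr fun y hy _ _ => ballRel_iff (hs y hy)

/-- Merge all the colors outside `t` into one. -/
noncomputable def mergeColor {K : Type} (c : V → K) (t : Finset K) (a : V) : Option K :=
  if c a ∈ t then some (c a) else none

theorem card_image_mergeColor {K : Type} {c : V → K} {t : Finset K} {x : Finset V}
    (hx : ∃ a ∈ x, c a ∉ t) (htx : ∀ u ∈ t, ∃ a ∈ x, c a = u) :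
    (x.image (mergeColor c t)).card = t.card + 1 := by
  have : x.image (mergeColor c t) = insert none (t.image some) := by
    ext u
    obtain ⟨b, hb, hbt⟩ := hx
    simp only [Finset.mem_image, Finset.mem_insert, mergeColor]
    constructor
    · rintro ⟨a, -, rfl⟩
      by_cases ha : c a ∈ t
      · exact .inr ⟨c a, ha, by simp [ha]⟩
      · exact .inl (by simp [ha])
    · rintro (rfl | ⟨v, hv, rfl⟩)
      · exact ⟨b, hb, by simp [hbt]⟩
      · obtain ⟨a, ha, rfl⟩ := htx v hv
        exact ⟨a, ha, by simp [hv]⟩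
  rw [this, Finset.card_insert_of_notMem (by simp),
    Finset.card_image_of_injective _ (Option.some_injective K)]

theorem forall_mergeColor_iff {K : Type} {c : V → K} {t : Finset K} {x y : Finset V}
    (hx : ∃ a ∈ x, c a ∉ t) (htx : ∀ u ∈ t, ∃ a ∈ x, c a = u) :
    (∀ a ∈ x, ∃ b ∈ y, mergeColor c t b = mergeColor c t a) ↔
      (∀ u ∈ t, ∃ a ∈ y, c a = u) ∧ ∃ a ∈ y, c a ∉ t := by
  have key : ∀ a b, mergeColor c t b = mergeColor c t a ↔
      (c a ∈ t ∧ c b = c a) ∨ (c a ∉ t ∧ c b ∉ t) := by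
    intro a b
    by_cases ha : c a ∈ t <;> by_cases hb : c b ∈ t <;> simp [mergeColor, ha, hb]
    exact fun h => hb (h ▸ ha)
  simp only [key]
  constructor
  · intro h
    refine ⟨fun u hu => ?_, ?_⟩
    · obtain ⟨a, ha, rfl⟩ := htx u hu
      obtain ⟨b, hb, h' | h'⟩ := h a ha
      · exact ⟨b, hb, h'.2⟩
      · exact absurd hu h'.1
    · obtain ⟨a, ha, hat⟩ := hx
      obtain ⟨b, hb, h' | h'⟩ := h a ha
      · exact absurd h'.1 hat
      · exact ⟨b, hb, h'.2⟩
  · rintro ⟨h1, b, hb, hbt⟩ a _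
    by_cases ha : c a ∈ t
    · obtain ⟨e, he, hea⟩ := h1 _ ha
      exact ⟨e, he, .inl ⟨ha, hea⟩⟩
    · exact ⟨b, hb, .inr ⟨ha, hbt⟩⟩

theorem ne_empty_of_covers {K : Type} {c : V → K} {t : Finset K} (ht : t.Nonempty) {y : Finset V}
    (hy : ∀ u ∈ t, ∃ a ∈ y, c a = u) : y ≠ ∅ := by
  obtain ⟨u, hu⟩ := ht
  obtain ⟨a, ha, -⟩ := hy u hu
  exact Finset.ne_empty_of_mem ha

/-- The proper subsets of `x` attaining exactly the colors of `t`, all of which are attained by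
`x`, form a sphere if `x` has no other colors. -/
theorem isSphere_inclGraph_of_covers {K : Type} (c : V → K) (t : Finset K) {x : Finset V}
    {s : Finset (Finset V)} (hx : ∀ a ∈ x, c a ∈ t) (htx : ∀ u ∈ t, ∃ a ∈ x, c a = u)
    (hs : ∀ y, y ∈ s ↔ y ⊂ x ∧ ∀ u ∈ t, ∃ a ∈ y, c a = u) :
    IsSphere (x.card - t.card - 1) (inclGraph s) := by
  have himg : x.image c = t := by
    ext u
    rw [Finset.mem_image]
    exact ⟨fun ⟨a, ha, h⟩ => h ▸ hx a ha, htx u⟩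
  have hle : t.card ≤ x.card := himg ▸ Finset.card_image_le
  have := isSphere_inclGraph_of_colors (n := x.card - t.card) c (x := x) (s := s) (fun y => by
    rw [hs]
    refine and_congr_right fun _ => ⟨fun h a ha => h _ (hx a ha), fun h u hu => ?_⟩
    obtain ⟨a, ha, rfl⟩ := htx u hu
    exact h a ha) (by rw [himg]; lia)
  rwa [Nat.cast_sub hle] at this

/-- If `x` has colors outside `t`, the proper subsets of `x` attaining all the colors of `t` form a
ball: they become a sphere after adding a vertex linked to those having a color outside `t`. -/
theorem isSphere_ballRel {K : Type} (c : V → K) (t : Finset K) (ht : t.Nonempty) {x : Finset V}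
    {s : Finset (Finset V)} (hx : ∃ a ∈ x, c a ∉ t) (htx : ∀ u ∈ t, ∃ a ∈ x, c a = u)
    (hs : ∀ y, y ∈ s ↔ y = ∅ ∨ (y ⊂ x ∧ ∀ u ∈ t, ∃ a ∈ y, c a = u)) :
    IsSphere (x.card - t.card - 1) (relGraph (ballRel c t) s) := by
  induction hn : x.card using Nat.strong_induction_on generalizing x s with
  | _ n ih =>
    have hcard := card_image_mergeColor hx htx
    have hle : t.card + 1 ≤ x.card := hcard ▸ Finset.card_image_le
    refine isSphere_relGraph_iff.mpr (.inr ⟨isManifold_relGraph_iff.mpr ⟨by lia, ?_⟩,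
      ∅, (hs ∅).mpr (.inl rfl), ?_⟩)
    · intro y hy
      by_cases hy0 : y = ∅
      · subst hy0
        rw [relGraph_ballRel fun y hy => (Finset.mem_keep.mp hy).2.1.symm]
        have := isSphere_inclGraph_of_colors (n := x.card - (t.card + 1)) (mergeColor c t)
          (x := x) (s := s.keep (Linked (ballRel c t) ∅)) (fun y => by
            rw [forall_mergeColor_iff hx htx, Finset.mem_keep, hs]
            constructor
            · rintro ⟨h1 | h1, h2, h3 | h3⟩
              · exact absurd h1.symm h2
              · exact absurd h1.symm h2
              · exact ⟨h1.1, h1.2, h3.2 rfl⟩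
              · exact absurd h3.1 (by simp)
            · rintro ⟨h1, h2, h3⟩
              have hy := ne_empty_of_covers ht h2
              exact ⟨.inr ⟨h1, h2⟩, hy.symm, .inl
                ⟨(Finset.empty_subset y).ssubset_of_ne hy.symm, fun _ => h3⟩⟩)
          (by rw [hcard]; lia)
        convert this using 1
        push_cast [hle]
        lia
      · obtain ⟨hyx, hyt⟩ := ((hs y).mp hy).resolve_left hy0
        have hupp := isSphere_inclGraph_Ioo hyx (s := s.keep (y ⊂ ·)) (fun z => by
          rw [Finset.mem_keep, hs]
          constructor
          · rintro ⟨rfl | h, h'⟩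
            · exact absurd h' (by simp)
            · exact ⟨h', h.1⟩
          · refine fun h => ⟨.inr ⟨h.2, fun u hu => ?_⟩, h.1⟩
            obtain ⟨a, ha, hau⟩ := hyt u hu
            exact ⟨a, h.1.1 ha, hau⟩)
        rw [← relGraph_ballRel (c := c) (t := t) fun z hz => by
          rintro rfl
          exact absurd (Finset.mem_keep.mp hz).2 (by simp)] at hupp
        have hlt := Finset.card_lt_card hyx
        have hlow : IsSphere (y.card - t.card - 1)
            (relGraph (ballRel c t) (s.keep (ballRel c t · y))) := by
          by_cases hyr : ∃ a ∈ y, c a ∉ t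
          · refine ih _ (hn ▸ hlt) hyr hyt (fun z => ?_) rfl
            rw [Finset.mem_keep, hs]
            constructor
            · rintro ⟨rfl | h, h'⟩
              · exact .inl rfl
              · exact .inr ⟨h'.1, h.2⟩
            · rintro (rfl | h)
              · exact ⟨.inl rfl, (Finset.empty_subset y).ssubset_of_ne (Ne.symm hy0),
                  fun _ => hyr⟩
              · exact ⟨.inr ⟨h.1.trans hyx, h.2⟩, (ballRel_iff (ne_empty_of_covers ht h.2)).mpr h.1⟩
          · rw [relGraph_ballRel fun z hz hz0 => hyr ((Finset.mem_keep.mp hz).2.2 hz0)]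
            push Not at hyr
            refine isSphere_inclGraph_of_covers c t hyr hyt fun z => ?_
            rw [Finset.mem_keep, hs]
            constructor
            · rintro ⟨rfl | h, h'⟩
              · obtain ⟨a, ha, hat⟩ := h'.2 rfl
                exact absurd (hyr a ha) hat
              · exact ⟨h'.1, h.2⟩
            · exact fun h => ⟨.inr ⟨h.1.trans hyx, h.2⟩,
                (ballRel_iff (ne_empty_of_covers ht h.2)).mpr h.1⟩
        have := hlow.join hupp (s := s.keep (Linked (ballRel c t) y))
          (fun z => by
            simp only [Finset.mem_keep, Linked, ballRel_iff hy0]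
            have h1 : y ⊂ z → y ≠ z := fun h => h.ne
            have h2 : ballRel c t z y → y ≠ z := fun h => h.1.ne'
            tauto)
          (fun z hz w hw => by
            have hzy := (Finset.mem_keep.mp hz).2
            have hyw := (Finset.mem_keep.mp hw).2
            refine ⟨(hzy.1.trans hyw).ne, .inl ⟨hzy.1.trans hyw, fun h0 => ?_⟩⟩
            obtain ⟨a, ha, hat⟩ := hzy.2 h0
            exact ⟨a, hyw.1 ha, hat⟩)
        convert this using 1
        lia
    · rw [relGraph_ballRel fun y hy => (Finset.mem_keep.mp hy).2]
      obtain ⟨a, ha, hat⟩ := hx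
      have herase : ∀ y : Finset V, (∀ u ∈ t, ∃ b ∈ y, c b = u) →
          ∀ u ∈ t, ∃ b ∈ y.erase a, c b = u := by
        intro y hy u hu
        obtain ⟨b, hb, rfl⟩ := hy u hu
        exact ⟨b, Finset.mem_erase.mpr ⟨fun h => hat (h ▸ hu), hb⟩, rfl⟩
      refine contractible_of_retract_down (s₀ := (s.keep (· ≠ ∅)).keep (a ∉ ·))
        (Finset.keep_subset _ _) (·.erase a) ?_ (contractible_of_cone (a := x.erase a) ?_ ?_)
      · intro y hy hy₀
        have hay : a ∈ y := by
          by_contra h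
          exact hy₀ (Finset.mem_keep.mpr ⟨hy, h⟩)
        obtain ⟨hys, hy0⟩ := Finset.mem_keep.mp hy
        obtain ⟨hyx, hyt⟩ := ((hs y).mp hys).resolve_left hy0
        have := herase y hyt
        refine ⟨?_, Finset.erase_ssubset hay, fun z hz hzy =>
          Finset.subset_erase.mpr ⟨hzy.1, (Finset.mem_keep.mp hz).2⟩⟩
        simp only [Finset.mem_keep, hs]
        exact ⟨⟨.inr ⟨(Finset.erase_subset a y).trans_ssubset hyx, this⟩,
          ne_empty_of_covers ht this⟩, Finset.notMem_erase a y⟩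
      · have := herase x htx
        simp only [Finset.mem_keep, hs]
        exact ⟨⟨.inr ⟨Finset.erase_ssubset ha, this⟩, ne_empty_of_covers ht this⟩,
          Finset.notMem_erase a x⟩
      · intro y hy hyne
        simp only [Finset.mem_keep, hs] at hy
        exact (linked_of_ssubset ((Finset.subset_erase.mpr
          ⟨(hy.1.1.resolve_left hy.1.2).1.1, hy.2⟩).ssubset_of_ne hyne)).symm

end Inclusion

section Above

theorem mem_verts_barycentric {G : FGraph V} {x : Finset V} :
    x ∈ G.barycentric.verts ↔ G.IsSimplex x :=
  Finset.mem_filter.trans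
    ⟨fun h => h.2, fun h => ⟨Finset.mem_powerset.mpr fun _ ha => h.2.1 ha, h⟩⟩

theorem nonempty_of_ssubset {x y : Finset V} (h : x ⊂ y) : y.Nonempty :=
  (Finset.exists_of_ssubset h).imp fun _ h => h.1

theorem IsSimplex.mono {G : FGraph V} {x y : Finset V} (hx : G.IsSimplex x) (hyx : y ⊆ x)
    (hy : y.Nonempty) : G.IsSimplex y :=
  ⟨hy, fun _ ha => hx.2.1 (hyx ha), fun a ha b hb => hx.2.2 a (hyx ha) b (hyx hb)⟩

theorem isSimplex_insert {G : FGraph V} {x : Finset V} {v : V} (hx : ∀ a ∈ x, a ∈ G.verts)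
    (hxx : ∀ a ∈ x, ∀ b ∈ x, a ≠ b → G.Adj a b) (hv : v ∈ G.verts ∧ ∀ a ∈ x, G.Adj a v) :
    G.IsSimplex (insert v x) := by
  refine ⟨Finset.insert_nonempty v x, fun a ha => ?_, fun a ha b hb hab => ?_⟩
  · rcases Finset.mem_insert.mp ha with rfl | hax
    · exact hv.1
    · exact hx a hax
  · rcases Finset.mem_insert.mp ha with rfl | hax <;> rcases Finset.mem_insert.mp hb with rfl | hbx
    · exact absurd rfl hab
    · exact G.symm (hv.2 b hbx)
    · exact hv.2 a hax
    · exact hxx a hax b hbx hab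

/-- The simplices of `G` which strictly contain `x`. -/
noncomputable def above (G : FGraph V) (x : Finset V) : Finset (Finset V) :=
  G.barycentric.verts.keep (x ⊂ ·)

theorem mem_above {G : FGraph V} {x z : Finset V} : z ∈ G.above x ↔ G.IsSimplex z ∧ x ⊂ z := by
  rw [above, Finset.mem_keep, mem_verts_barycentric]

/-- If `H` is a contractible full subgraph of the link of the clique `x`, then the simplices which
strictly contain `x` and have their remaining vertices in `H` form a contractible graph. -/
theorem contractible_inclGraph_above {G H : FGraph V} (hH : Contractible H) {x : Finset V}
    (hx : ∀ a ∈ x, a ∈ G.verts) (hxx : ∀ a ∈ x, ∀ b ∈ x, a ≠ b → G.Adj a b)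
    (hHG : ∀ v ∈ H.verts, v ∈ G.verts ∧ ∀ a ∈ x, G.Adj a v)
    (hadj : ∀ u ∈ H.verts, ∀ v ∈ H.verts, H.Adj u v ↔ G.Adj u v) {s : Finset (Finset V)}
    (hs : ∀ z, z ∈ s ↔ G.IsSimplex z ∧ x ⊂ z ∧ ∀ a ∈ z, a ∉ x → a ∈ H.verts) :
    Contractible (inclGraph s) := by
  induction hH generalizing x s with
  | single H v hHv =>
    have hv : v ∈ H.verts := by simp [hHv]
    have hvx : v ∉ x := fun h => G.loopless v ((hHG v hv).2 v h)
    have hmem : insert v x ∈ s := (hs _).mpr ⟨isSimplex_insert hx hxx (hHG v hv),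
      Finset.ssubset_insert hvx, fun a ha hax => by
        rwa [(Finset.mem_insert.mp ha).resolve_right hax]⟩
    refine contractible_of_cone hmem fun z hz hne => linked_of_ssubset ?_
    obtain ⟨-, hxz, hzH⟩ := (hs z).mp hz
    obtain ⟨a, ha, hax⟩ := Finset.exists_of_ssubset hxz
    have hav : a = v := by simpa [hHv] using hzH a ha hax
    exact (Finset.insert_subset (hav ▸ ha) hxz.1).ssubset_of_ne hne.symm
  | step H v hv _ _ ih1 ih2 =>
    have hvx : v ∉ x := fun h => G.loopless v ((hHG v hv).2 v h)
    have hmem : insert v x ∈ s := (hs _).mpr ⟨isSimplex_insert hx hxx (hHG v hv),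
      Finset.ssubset_insert hvx, fun a ha hax => by
        rwa [(Finset.mem_insert.mp ha).resolve_right hax]⟩
    have hsph : ∀ w, w ∈ (H.unitSphere v).verts ↔ w ∈ H.verts ∧ H.Adj v w :=
      fun w => mem_induce
    have hera : ∀ w, w ∈ (H.erase v).verts ↔ w ∈ H.verts ∧ w ≠ v := fun w => mem_induce
    refine contractible_relGraph_step hmem ?_ ?_
    · have hHG' : ∀ w ∈ (H.unitSphere v).verts,
          w ∈ G.verts ∧ ∀ a ∈ insert v x, G.Adj a w := by
        intro w hw
        obtain ⟨hwH, hvw⟩ := (hsph w).mp hw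
        refine ⟨(hHG w hwH).1, fun a ha => ?_⟩
        rcases Finset.mem_insert.mp ha with h | h
        · exact h ▸ (hadj v hv w hwH).mp hvw
        · exact (hHG w hwH).2 a h
      have hs' : ∀ z, z ∈ s.keep (Linked (· ⊂ ·) (insert v x)) ↔ G.IsSimplex z ∧
          insert v x ⊂ z ∧ ∀ a ∈ z, a ∉ insert v x → a ∈ (H.unitSphere v).verts := by
        intro z
        rw [Finset.mem_keep, linked_ssubset_iff, hs]
        constructor
        · rintro ⟨⟨h1, h2, h3⟩, h4⟩
          have h4 : insert v x ⊂ z := by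
            refine h4.resolve_right fun h => ?_
            obtain ⟨a, ha, hax⟩ := Finset.exists_of_ssubset h2
            obtain rfl := (Finset.mem_insert.mp (h.1 ha)).resolve_right hax
            exact h.2 (Finset.insert_subset ha h2.1)
          refine ⟨h1, h4, fun a ha hax => ?_⟩
          rw [Finset.mem_insert, not_or] at hax
          have haH := h3 a ha hax.2
          exact (hsph a).mpr ⟨haH, (hadj v hv a haH).mpr
            (h1.2.2 v (h4.1 (Finset.mem_insert_self v x)) a ha (Ne.symm hax.1))⟩
        · rintro ⟨h1, h2, h3⟩
          refine ⟨⟨h1, (Finset.ssubset_insert hvx).trans h2, fun a ha hax => ?_⟩, .inl h2⟩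
          by_cases hav : a = v
          · exact hav ▸ hv
          · exact ((hsph a).mp (h3 a ha (by simp [hav, hax]))).1
      have hvs := isSimplex_insert hx hxx (hHG v hv)
      refine ih1 (fun a ha => hvs.2.1 ha) hvs.2.2 hHG' ?_ hs'
      intro u hu w hw
      obtain ⟨hu, hvu⟩ := (hsph u).mp hu
      obtain ⟨hw, hvw⟩ := (hsph w).mp hw
      rw [← hadj u hu w hw]
      exact ⟨fun h => h.1, fun h => ⟨h, hvu, hvw⟩⟩
    · have hs' : ∀ z, z ∈ s.keep (v ∉ ·) ↔ G.IsSimplex z ∧ x ⊂ z ∧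
          ∀ a ∈ z, a ∉ x → a ∈ (H.erase v).verts := by
        intro z
        rw [Finset.mem_keep, hs]
        constructor
        · rintro ⟨⟨h1, h2, h3⟩, h4⟩
          exact ⟨h1, h2, fun a ha hax => (hera a).mpr ⟨h3 a ha hax, fun h => h4 (h ▸ ha)⟩⟩
        · rintro ⟨h1, h2, h3⟩
          exact ⟨⟨h1, h2, fun a ha hax => ((hera a).mp (h3 a ha hax)).1⟩,
            fun h => ((hera v).mp (h3 v h hvx)).2 rfl⟩
      refine contractible_of_retract_down (s₀ := s.keep (v ∉ ·)) ?_ (·.erase v) ?_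
        (ih2 hx hxx (fun w hw => hHG w ((hera w).mp hw).1) ?_ hs')
      · intro z hz
        obtain ⟨hz, hvz⟩ := Finset.mem_keep.mp hz
        exact Finset.mem_keep.mpr ⟨hz, fun h => hvz (h ▸ Finset.mem_insert_self v x)⟩
      · intro z hz hz₀
        obtain ⟨hz, hne⟩ := Finset.mem_keep.mp hz
        have hvz : v ∈ z := by
          by_contra h
          exact hz₀ (Finset.mem_keep.mpr ⟨hz, h⟩)
        obtain ⟨h1, h2, h3⟩ := (hs z).mp hz
        have h4 : x ⊂ z.erase v := by
          refine (Finset.subset_erase.mpr ⟨h2.1, hvx⟩).ssubset_of_ne ?_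
          rintro rfl
          exact hne (Finset.insert_erase hvz).symm
        refine ⟨Finset.mem_keep.mpr ⟨(hs _).mpr ⟨h1.mono (Finset.erase_subset v z)
          (nonempty_of_ssubset h4), h4, fun a ha => h3 a (Finset.mem_of_mem_erase ha)⟩,
          Finset.notMem_erase v z⟩, Finset.erase_ssubset hvz, fun w hw hwz =>
          Finset.subset_erase.mpr ⟨hwz.1, (Finset.mem_keep.mp hw).2⟩⟩
      · intro u hu w hw
        obtain ⟨hu, hvu⟩ := (hera u).mp hu
        obtain ⟨hw, hvw⟩ := (hera w).mp hw
        rw [← hadj u hu w hw]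
        exact ⟨fun h => h.1, fun h => ⟨h, hvu, hvw⟩⟩

/-- The subgraph induced on the common neighbors of `x`. -/
noncomputable def link (G : FGraph V) (x : Finset V) : FGraph V :=
  G.induce fun v => ∀ a ∈ x, G.Adj a v

theorem mem_link {G : FGraph V} {x : Finset V} {v : V} :
    v ∈ (G.link x).verts ↔ v ∈ G.verts ∧ ∀ a ∈ x, G.Adj a v :=
  mem_induce

theorem isSphere_link {G : FGraph V} {d : ℤ} (hG : IsManifold d G) {x : Finset V}
    (hx : G.IsSimplex x) : IsSphere (d - x.card) (G.link x) := by
  induction x using Finset.induction_on generalizing G d with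
  | empty => exact absurd hx.1 (by simp)
  | insert v x hvx ih =>
    have hv : v ∈ G.verts := hx.2.1 (Finset.mem_insert_self v x)
    have hS := (isManifold_iff.mp hG).2 v hv
    rw [Finset.card_insert_of_notMem hvx]
    rcases x.eq_empty_or_nonempty with rfl | hne
    · simpa [link, unitSphere] using hS
    · have hxv : ∀ a ∈ x, G.Adj v a := fun a ha => hx.2.2 v (Finset.mem_insert_self v x) a
        (Finset.mem_insert_of_mem ha) fun h => hvx (h ▸ ha)
      have hsub : ∀ a ∈ x, a ∈ (G.unitSphere v).verts := fun a ha =>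
        mem_induce.mpr ⟨G.mem_of_adj_right (hxv a ha), hxv a ha⟩
      have hxS : (G.unitSphere v).IsSimplex x := ⟨hne, fun a ha => hsub a ha,
        fun a ha b hb hab => ⟨hx.2.2 a (Finset.mem_insert_of_mem ha) b
          (Finset.mem_insert_of_mem hb) hab, hxv a ha, hxv b hb⟩⟩
      rcases isSphere_iff.mp hS with ⟨-, h⟩ | ⟨hm, -⟩
      · obtain ⟨a, ha⟩ := hne
        simpa [h] using hsub a ha
      · have hlink : G.link (insert v x) = (G.unitSphere v).link x := by
          refine ext ?_ fun b c => ?_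
          · ext w
            rw [mem_link, mem_link, Finset.forall_mem_insert]
            constructor
            · rintro ⟨h1, h2, h3⟩
              exact ⟨mem_induce.mpr ⟨h1, h2⟩, fun a ha => ⟨h3 a ha, hxv a ha, h2⟩⟩
            · rintro ⟨h1, h2⟩
              obtain ⟨h1, h3⟩ := mem_induce.mp h1
              exact ⟨h1, h3, fun a ha => (h2 a ha).1⟩
          · simp only [link, induce, unitSphere, Finset.forall_mem_insert]
            constructor
            · rintro ⟨h1, ⟨h2, h3⟩, h4, h5⟩
              exact ⟨⟨h1, h2, h4⟩, fun a ha => ⟨h3 a ha, hxv a ha, h2⟩,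
                fun a ha => ⟨h5 a ha, hxv a ha, h4⟩⟩
            · rintro ⟨⟨h1, h2, h4⟩, h3, h5⟩
              exact ⟨h1, ⟨h2, fun a ha => (h3 a ha).1⟩, h4, fun a ha => (h5 a ha).1⟩
        rw [hlink]
        convert ih hm hxS using 1
        push_cast
        ring

/-- In a `d`-manifold, the simplices strictly containing a given simplex form a sphere. -/
theorem isSphere_above {G : FGraph V} {d : ℤ} (hG : IsManifold d G) {x : Finset V}
    (hx : G.IsSimplex x) : IsSphere (d - x.card) (inclGraph (G.above x)) := by
  induction hn : G.verts.card - x.card using Nat.strong_induction_on generalizing x with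
  | _ n ih =>
    have hmem : ∀ v ∈ (G.link x).verts, insert v x ∈ G.above x := by
      intro v hv
      have hv := mem_link.mp hv
      exact mem_above.mpr ⟨isSimplex_insert (fun a ha => hx.2.1 ha) hx.2.2 hv,
        Finset.ssubset_insert fun h => G.loopless v (hv.2 v h)⟩
    have hdiff : ∀ z ∈ G.above x, ∀ a ∈ z, a ∉ x → a ∈ (G.link x).verts := by
      intro z hz a ha hax
      obtain ⟨hz, hxz⟩ := mem_above.mp hz
      exact mem_link.mpr ⟨hz.2.1 ha, fun b hb => hz.2.2 b (hxz.1 hb) a ha fun h => hax (h ▸ hb)⟩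
    rcases isSphere_iff.mp (isSphere_link hG hx) with ⟨hd, hempty⟩ | ⟨hm, v, hv, hc⟩
    · rw [hd]
      refine .empty _ (Finset.eq_empty_of_forall_notMem fun z hz => ?_)
      obtain ⟨a, ha, hax⟩ := Finset.exists_of_ssubset (mem_above.mp hz).2
      simpa [hempty] using hdiff z hz a ha hax
    · have hvx : v ∉ x := fun h => G.loopless v ((mem_link.mp hv).2 v h)
      have hera : ∀ w, w ∈ ((G.link x).erase v).verts ↔ w ∈ (G.link x).verts ∧ w ≠ v :=
        fun w => mem_induce
      refine isSphere_relGraph_iff.mpr (.inr ⟨isManifold_relGraph_iff.mpr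
        ⟨(isManifold_iff.mp hm).1, fun z hz => ?_⟩, insert v x, hmem v hv, ?_⟩)
      · obtain ⟨hzs, hxz⟩ := mem_above.mp hz
        have hlt := Finset.card_lt_card hxz
        have hle : z.card ≤ G.verts.card := Finset.card_le_card fun a ha => hzs.2.1 ha
        have hlow := isSphere_inclGraph_Ioo hxz (s := (G.above x).keep (· ⊂ z)) fun w => by
          rw [Finset.mem_keep, mem_above]
          exact ⟨fun h => ⟨h.1.2, h.2⟩,
            fun h => ⟨⟨hzs.mono h.2.1 (nonempty_of_ssubset h.1), h.1⟩, h.2⟩⟩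
        have := hlow.join (ih _ (by lia) hzs rfl)
          (s := (G.above x).keep (Linked (· ⊂ ·) z))
          (fun w => by
            have : z ⊂ w → x ⊂ w := hxz.trans
            simp only [Finset.mem_keep, mem_above, linked_ssubset_iff]
            tauto)
          (fun u hu w hw => linked_of_ssubset
            ((Finset.mem_keep.mp hu).2.trans (mem_above.mp hw).2))
        convert this using 1
        ring
      · refine contractible_of_retract_down (s₀ := (G.above x).keep (v ∉ ·)) ?_ (·.erase v) ?_
          (contractible_inclGraph_above (G := G) hc (x := x) (fun a ha => hx.2.1 ha) hx.2.2 ?_ ?_ ?_)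
        · intro z hz
          obtain ⟨hz, hvz⟩ := Finset.mem_keep.mp hz
          exact Finset.mem_keep.mpr ⟨hz, fun h => hvz (h ▸ Finset.mem_insert_self v x)⟩
        · intro z hz hz₀
          obtain ⟨hz, hne⟩ := Finset.mem_keep.mp hz
          have hvz : v ∈ z := by
            by_contra h
            exact hz₀ (Finset.mem_keep.mpr ⟨hz, h⟩)
          obtain ⟨h1, h2⟩ := mem_above.mp hz
          have h4 : x ⊂ z.erase v := by
            refine (Finset.subset_erase.mpr ⟨h2.1, hvx⟩).ssubset_of_ne ?_
            rintro rfl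
            exact hne (Finset.insert_erase hvz).symm
          exact ⟨Finset.mem_keep.mpr ⟨mem_above.mpr ⟨h1.mono (Finset.erase_subset v z)
            (nonempty_of_ssubset h4), h4⟩, Finset.notMem_erase v z⟩,
            Finset.erase_ssubset hvz, fun w hw hwz =>
            Finset.subset_erase.mpr ⟨hwz.1, (Finset.mem_keep.mp hw).2⟩⟩
        · exact fun w hw => mem_link.mp ((hera w).mp hw).1
        · intro u hu w hw
          obtain ⟨hu, hvu⟩ := (hera u).mp hu
          obtain ⟨hw, hvw⟩ := (hera w).mp hw
          exact ⟨fun h => h.1.1, fun h => ⟨⟨h, (mem_link.mp hu).2, (mem_link.mp hw).2⟩, hvu, hvw⟩⟩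
        · intro z
          rw [Finset.mem_keep]
          constructor
          · rintro ⟨hz, hvz⟩
            exact ⟨(mem_above.mp hz).1, (mem_above.mp hz).2, fun a ha hax =>
              (hera a).mpr ⟨hdiff z hz a ha hax, fun h => hvz (h ▸ ha)⟩⟩
          · rintro ⟨h1, h2, h3⟩
            exact ⟨mem_above.mpr ⟨h1, h2⟩, fun h => ((hera v).mp (h3 v h hvx)).2 rfl⟩

end Above

end FGraph

/-- If `G` is a `d`-manifold, `ψ : V → ℂ` has nowhere-vanishing real and
imaginary parts on `V`, and `t` is a 3-element subset of `U = {1+i,1-i,-1+i,-1-i}`, then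
`Ψ^{-1}(t)` is either the empty graph or a `(d-2)`-manifold with boundary. -/
theorem sign_preimage_manifold_with_boundary {V : Type} (G : FGraph V) (d : ℤ)
    (hG : FGraph.IsManifold d G) (ψ : V → ℂ)
    (hψ : ∀ v ∈ G.verts, (ψ v).re ≠ 0 ∧ (ψ v).im ≠ 0)
    (t : Finset ℂ) (ht : t ⊆ signU) (htc : t.card = 3) :
    (G.signPreimage ψ t).verts = ∅ ∨
      FGraph.IsManifoldWithBoundary (d - 2) (G.signPreimage ψ t) := by
  refine .inr fun x hx => ?_
  obtain ⟨hxG, hxt⟩ := FGraph.mem_induce.mp hx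
  rw [FGraph.mem_verts_barycentric] at hxG
  set c : V → ℂ := fun v => csgn (ψ v - 0) with hc
  have hsv : ∀ y : Finset V, (∀ u ∈ t, u ∈ FGraph.signValues ψ 0 y) ↔
      ∀ u ∈ t, ∃ a ∈ y, c a = u := fun y => by
    simp only [FGraph.signValues, Finset.mem_image, hc]
  rw [hsv] at hxt
  have htne : t.Nonempty := Finset.card_pos.mp (by lia)
  set low : Finset (Finset V) :=
    x.ssubsets.keep fun y => ∀ u ∈ t, ∃ a ∈ y, c a = u with hlow
  have mem_low : ∀ y, y ∈ low ↔ y ⊂ x ∧ ∀ u ∈ t, ∃ a ∈ y, c a = u := fun y => by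
    rw [hlow, Finset.mem_keep, Finset.mem_ssubsets]
  have hlow_above : ∀ y ∈ low, ∀ z ∈ G.above x, y ⊂ z := fun y hy z hz =>
    ((mem_low y).mp hy).1.trans (FGraph.mem_above.mp hz).2
  have habove := FGraph.isSphere_above hG hxG
  obtain ⟨s, hs⟩ : ∃ s : Finset (Finset V), ∀ y, y ∈ s ↔ y ∈ low ∨ y ∈ G.above x :=
    ⟨low ∪ G.above x, fun y => Finset.mem_union⟩
  have hne : ∀ y ∈ s, y ≠ ∅ := by
    intro y hy
    rcases (hs y).mp hy with h | h
    · exact FGraph.ne_empty_of_covers htne ((mem_low y).mp h).2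
    · exact Finset.nonempty_iff_ne_empty.mp (FGraph.mem_above.mp h).1.1
  have hsimplex : ∀ y ∈ s, G.IsSimplex y := by
    intro y hy
    rcases (hs y).mp hy with h | h
    · exact hxG.mono ((mem_low y).mp h).1.1 (Finset.nonempty_iff_ne_empty.mpr (hne y hy))
    · exact (FGraph.mem_above.mp h).1
  have hcov : ∀ y ∈ s, ∀ u ∈ t, ∃ a ∈ y, c a = u := by
    intro y hy u hu
    rcases (hs y).mp hy with h | h
    · exact ((mem_low y).mp h).2 u hu
    · obtain ⟨a, ha, hau⟩ := hxt u hu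
      exact ⟨a, (FGraph.mem_above.mp h).2.1 ha, hau⟩
  have hcmp : ∀ y ∈ s, x ⊂ y ∨ y ⊂ x := by
    intro y hy
    rcases (hs y).mp hy with h | h
    · exact .inr ((mem_low y).mp h).1
    · exact .inl (FGraph.mem_above.mp h).2
  have hunit : (G.signPreimage ψ t).unitSphere x = FGraph.inclGraph s := by
    have mem_unit : ∀ y, y ∈ ((G.signPreimage ψ t).unitSphere x).verts ↔ y ∈ s := by
      intro y
      constructor
      · intro hy
        obtain ⟨-, ⟨-, hyG, hxy⟩, -, hyt⟩ := FGraph.mem_induce.mp hy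
        rw [hs, mem_low, FGraph.mem_above, ← hsv]
        tauto
      · intro hy
        have hyt := (hsv y).mpr (hcov y hy)
        exact FGraph.mem_induce.mpr ⟨FGraph.mem_induce.mpr
          ⟨FGraph.mem_verts_barycentric.mpr (hsimplex y hy), hyt⟩,
          ⟨hxG, hsimplex y hy, hcmp y hy⟩, (hsv x).mpr hxt, hyt⟩
    refine FGraph.ext (Finset.ext mem_unit) fun y z => ?_
    constructor
    · intro h
      exact ⟨(mem_unit y).mp (FGraph.mem_of_adj _ h),
        (mem_unit z).mp (FGraph.mem_of_adj_right _ h),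
        FGraph.linked_ssubset_iff.mpr h.1.1.2.2⟩
    · rintro ⟨hy, hz, hyz⟩
      have hy' := (FGraph.mem_induce.mp ((mem_unit y).mpr hy)).2
      have hz' := (FGraph.mem_induce.mp ((mem_unit z).mpr hz)).2
      exact ⟨⟨⟨hsimplex y hy, hsimplex z hz, FGraph.linked_ssubset_iff.mp hyz⟩, hy'.2.2, hz'.2.2⟩,
        hy', hz'⟩
  rw [hunit, show d - 2 - 1 = ((x.card : ℤ) - t.card - 1) + (d - x.card) + 1 by
    rw [htc]; push_cast; ring]
  by_cases hxc : ∃ a ∈ x, c a ∉ t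
  · refine .inr ?_
    have hball := FGraph.isSphere_ballRel c t htne hxc hxt (s := insert ∅ low) fun y => by
      rw [Finset.mem_insert, mem_low]
    rw [← FGraph.relGraph_ballRel (c := c) (t := t) fun y hy => hne y ((hs y).mpr (.inr hy))]
      at habove
    have hS := hball.join habove (s := insert ∅ s)
      (fun y => by rw [Finset.mem_insert, Finset.mem_insert, hs, or_assoc])
      (fun y hy z hz => by
        have hxz := (FGraph.mem_above.mp hz).2
        rcases Finset.mem_insert.mp hy with rfl | hy
        · have hz0 := hne z ((hs z).mpr (.inr hz))
          obtain ⟨a, ha, hat⟩ := hxc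
          exact ⟨hz0.symm, .inl ⟨(Finset.empty_subset z).ssubset_of_ne hz0.symm,
            fun _ => ⟨a, hxz.1 ha, hat⟩⟩⟩
        · have hyz := hlow_above y hy z hz
          exact ⟨hyz.ne, .inl ((FGraph.ballRel_iff (hne y ((hs y).mpr (.inl hy)))).mpr hyz)⟩)
    have hB := FGraph.isBall_erase hS (v := ∅) (Finset.mem_insert_self ∅ s)
    rw [FGraph.erase_relGraph] at hB
    convert hB using 1
    rw [← FGraph.relGraph_ballRel (c := c) (t := t) hne]
    congr 1
    ext y
    rw [Finset.mem_keep, Finset.mem_insert]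
    exact ⟨fun hy => ⟨.inr hy, hne y hy⟩, fun hy => hy.1.resolve_left hy.2⟩
  · push Not at hxc
    exact .inl ((FGraph.isSphere_inclGraph_of_covers c t hxc hxt mem_low).join habove hs
      fun y hy z hz => FGraph.linked_of_ssubset (hlow_above y hy z hz))
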